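/- arXiv:1902.10817 — 7 statements merged into one kernel-verified Lean document; each statement's English description precedes it below -/
import Mathlib

section
/- Let p > 1 and 1/p + 1/q = 1. If f and g are real functions defined on the interval [a,b] (a < b) such that |f|^p and |g|^q are Lebesgue integrable on [a,b], then ∫_a^b |f(x)g(x)| dx ≤ (1/(b-a)) · [ (∫_a^b (b-x)|f(x)|^p dx)^{1/p} (∫_a^b (b-x)|g(x)|^q dx)^{1/q} + (∫_a^b (x-a)|f(x)|^p dx)^{1/p} (∫_a^b (x-a)|g(x)|^q dx)^{1/q} ]. -/
open intervalIntegral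

open MeasureTheory in
/-- The `p`-th root of a nonnegative integrable function is in `L^p`. -/
theorem memLp_rpow_inv_of_integrable {α : Type*} [MeasurableSpace α] {μ : Measure α} {p : ℝ}
    (hp : 0 < p) {u : α → ℝ} (hu0 : 0 ≤ᵐ[μ] u) (hu : Integrable u μ) :
    MemLp (fun x => u x ^ (1 / p)) (ENNReal.ofReal p) μ := by
  have hm : AEStronglyMeasurable (fun x => u x ^ (1 / p)) μ :=
    (hu.aemeasurable.pow_const _).aestronglyMeasurable
  rw [← integrable_norm_rpow_iff hm (by simpa using hp) ENNReal.ofReal_ne_top,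
    ENNReal.toReal_ofReal hp.le]
  refine hu.congr ?_
  filter_upwards [hu0] with x hx
  rw [Real.norm_of_nonneg (Real.rpow_nonneg hx _), ← Real.rpow_mul hx,
    one_div_mul_cancel hp.ne', Real.rpow_one]

open MeasureTheory in
/-- Weighted Hölder inequality, together with integrability of the weighted product. -/
theorem weighted_holder {α : Type*} [MeasurableSpace α] {μ : Measure α} {p q : ℝ}
    (hpq : p.HolderConjugate q) {w f g : α → ℝ} (hw : 0 ≤ᵐ[μ] w)
    (hf : Integrable (fun x => w x * |f x| ^ p) μ)
    (hg : Integrable (fun x => w x * |g x| ^ q) μ) :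
    Integrable (fun x => w x * |f x * g x|) μ ∧
      ∫ x, w x * |f x * g x| ∂μ ≤
        (∫ x, w x * |f x| ^ p ∂μ) ^ (1 / p) * (∫ x, w x * |g x| ^ q ∂μ) ^ (1 / q) := by
  have hf0 : 0 ≤ᵐ[μ] fun x => w x * |f x| ^ p := by
    filter_upwards [hw] with x hx using mul_nonneg hx (by positivity)
  have hg0 : 0 ≤ᵐ[μ] fun x => w x * |g x| ^ q := by
    filter_upwards [hw] with x hx using mul_nonneg hx (by positivity)
  have hu := memLp_rpow_inv_of_integrable hpq.pos hf0 hf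
  have hv := memLp_rpow_inv_of_integrable hpq.symm.pos hg0 hg
  have root {r y z : ℝ} (hr : 0 < r) (hy : 0 ≤ y) :
      (y * |z| ^ r) ^ (1 / r) = y ^ (1 / r) * |z| := by
    rw [Real.mul_rpow hy (by positivity), ← Real.rpow_mul (abs_nonneg z),
      mul_one_div_cancel hr.ne', Real.rpow_one]
  have hprod : (fun x => (w x * |f x| ^ p) ^ (1 / p) * (w x * |g x| ^ q) ^ (1 / q)) =ᵐ[μ]
      fun x => w x * |f x * g x| := by
    filter_upwards [hw] with x hx
    have hsum : w x ^ (1 / p) * w x ^ (1 / q) = w x := by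
      rw [← Real.rpow_add_of_nonneg hx hpq.one_div_nonneg hpq.symm.one_div_nonneg,
        one_div, one_div, hpq.inv_add_inv_eq_one, Real.rpow_one]
    rw [root hpq.pos hx, root hpq.symm.pos hx, abs_mul, mul_mul_mul_comm, hsum]
  have cancel {r : ℝ} {u : α → ℝ} (hr : 0 < r) (hu0 : 0 ≤ᵐ[μ] u) :
      ∫ x, (u x ^ (1 / r)) ^ r ∂μ = ∫ x, u x ∂μ := by
    refine integral_congr_ae ?_
    filter_upwards [hu0] with x hx
    rw [← Real.rpow_mul hx, one_div_mul_cancel hr.ne', Real.rpow_one]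
  have : (ENNReal.ofReal p).HolderConjugate (ENNReal.ofReal q) := hpq.ennrealOfReal
  refine ⟨(hu.integrable_mul hv).congr hprod, ?_⟩
  rw [← integral_congr_ae hprod, ← cancel hpq.pos hf0, ← cancel hpq.symm.pos hg0]
  refine integral_mul_le_Lp_mul_Lq_of_nonneg hpq ?_ ?_ hu hv
  · filter_upwards [hf0] with x hx using Real.rpow_nonneg hx _
  · filter_upwards [hg0] with x hx using Real.rpow_nonneg hx _

open MeasureTheory in
/-- Weighted Hölder inequality on an interval, for a continuous weight. -/
theorem intervalIntegral_weighted_holder {a b p q : ℝ} (hab : a ≤ b)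
    (hpq : p.HolderConjugate q) {w f g : ℝ → ℝ} (hwc : Continuous w)
    (hw : ∀ x ∈ Set.Ioc a b, 0 ≤ w x)
    (hf : IntervalIntegrable (fun x => |f x| ^ p) volume a b)
    (hg : IntervalIntegrable (fun x => |g x| ^ q) volume a b) :
    IntervalIntegrable (fun x => w x * |f x * g x|) volume a b ∧
      ∫ x in a..b, w x * |f x * g x| ≤
        (∫ x in a..b, w x * |f x| ^ p) ^ (1 / p) * (∫ x in a..b, w x * |g x| ^ q) ^ (1 / q) := by
  have hwf := hf.continuousOn_mul hwc.continuousOn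
  have hwg := hg.continuousOn_mul hwc.continuousOn
  simp only [intervalIntegrable_iff_integrableOn_Ioc_of_le hab, integral_of_le hab] at hwf hwg ⊢
  exact weighted_holder hpq ((ae_restrict_iff' measurableSet_Ioc).2 (.of_forall hw)) hwf hwg

/-- Improved Hölder inequality for integrals (İşcan). -/
theorem improved_holder_integral (a b p q : ℝ) (hab : a < b)
    (hp : 1 < p) (hpq : 1 / p + 1 / q = 1) (f g : ℝ → ℝ)
    (hf : IntervalIntegrable (fun x => |f x| ^ p) MeasureTheory.volume a b)
    (hg : IntervalIntegrable (fun x => |g x| ^ q) MeasureTheory.volume a b) :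
    ∫ x in a..b, |f x * g x| ≤
      (1 / (b - a)) *
        ((∫ x in a..b, (b - x) * |f x| ^ p) ^ (1 / p) *
            (∫ x in a..b, (b - x) * |g x| ^ q) ^ (1 / q) +
          (∫ x in a..b, (x - a) * |f x| ^ p) ^ (1 / p) *
            (∫ x in a..b, (x - a) * |g x| ^ q) ^ (1 / q)) := by
  have hc : p.HolderConjugate q :=
    Real.holderConjugate_iff.2 ⟨hp, by simpa only [one_div] using hpq⟩
  obtain ⟨hi₁, h₁⟩ := intervalIntegral_weighted_holder hab.le hc (w := fun x => b - x)
    (by fun_prop) (fun x hx => sub_nonneg.2 hx.2) hf hg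
  obtain ⟨hi₂, h₂⟩ := intervalIntegral_weighted_holder hab.le hc (w := fun x => x - a)
    (by fun_prop) (fun x hx => sub_nonneg.2 hx.1.le) hf hg
  have hba : 0 < b - a := sub_pos.2 hab
  have hsplit : (b - a) * ∫ x in a..b, |f x * g x| =
      (∫ x in a..b, (b - x) * |f x * g x|) + ∫ x in a..b, (x - a) * |f x * g x| := by
    rw [← integral_add hi₁ hi₂, ← integral_const_mul]
    congr 1 with x
    ring
  rw [one_div_mul_eq_div, le_div_iff₀' hba, hsplit]
  exact add_le_add h₁ h₂
end

section
/- Let a = (a_1, ..., a_n) and b = (b_1, ..., b_n) be two n-tuples of positive real numbers and let p, q > 1 with 1/p + 1/q = 1. Then ∑_{k=1}^n a_k b_k ≤ (1/n) · [ (∑_{k=1}^n k a_k^p)^{1/p} (∑_{k=1}^n k b_k^q)^{1/q} + (∑_{k=1}^n (n-k) a_k^p)^{1/p} (∑_{k=1}^n (n-k) b_k^q)^{1/q} ]. -/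
/-- **Weighted Hölder inequality** for finite sums of nonnegative real numbers. -/
theorem sum_weight_mul_le_rpow_mul_rpow {ι : Type*} (s : Finset ι) {p q : ℝ}
    (hpq : p.HolderConjugate q) {w f g : ι → ℝ} (hw : ∀ i ∈ s, 0 ≤ w i)
    (hf : ∀ i ∈ s, 0 ≤ f i) (hg : ∀ i ∈ s, 0 ≤ g i) :
    ∑ i ∈ s, w i * (f i * g i) ≤
      (∑ i ∈ s, w i * f i ^ p) ^ (1 / p) * (∑ i ∈ s, w i * g i ^ q) ^ (1 / q) := by
  have weight_mul_rpow {r x y : ℝ} (hr : r ≠ 0) (hx : 0 ≤ x) (hy : 0 ≤ y) :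
      (x ^ r⁻¹ * y) ^ r = x * y ^ r := by
    rw [Real.mul_rpow (Real.rpow_nonneg hx _) hy, Real.rpow_inv_rpow hx hr]
  have weight_split {x : ℝ} (hx : 0 ≤ x) : x ^ p⁻¹ * x ^ q⁻¹ = x := by
    rw [← Real.rpow_add_of_nonneg hx hpq.inv_nonneg hpq.symm.inv_nonneg,
      hpq.inv_add_inv_eq_one, Real.rpow_one]
  have holder := Real.inner_le_Lp_mul_Lq_of_nonneg s hpq
    (f := fun i => w i ^ p⁻¹ * f i) (g := fun i => w i ^ q⁻¹ * g i)
    (fun i hi => mul_nonneg (Real.rpow_nonneg (hw i hi) _) (hf i hi))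
    (fun i hi => mul_nonneg (Real.rpow_nonneg (hw i hi) _) (hg i hi))
  rw [Finset.sum_congr rfl fun i hi => weight_mul_rpow hpq.ne_zero (hw i hi) (hf i hi),
    Finset.sum_congr rfl fun i hi => weight_mul_rpow hpq.symm.ne_zero (hw i hi) (hg i hi)]
    at holder
  refine le_of_eq_of_le (Finset.sum_congr rfl fun i hi => ?_) holder
  rw [mul_mul_mul_comm, weight_split (hw i hi)]

/-- Improved Hölder inequality for sums (İşcan). -/
theorem improved_holder_sum (n : ℕ) (hn : 0 < n) (p q : ℝ)
    (hp : 1 < p) (hq : 1 < q) (hpq : 1 / p + 1 / q = 1)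
    (a b : ℕ → ℝ) (ha : ∀ k ∈ Finset.Icc 1 n, 0 < a k)
    (hb : ∀ k ∈ Finset.Icc 1 n, 0 < b k) :
    ∑ k ∈ Finset.Icc 1 n, a k * b k ≤
      (1 / (n : ℝ)) *
        ((∑ k ∈ Finset.Icc 1 n, (k : ℝ) * a k ^ p) ^ (1 / p) *
            (∑ k ∈ Finset.Icc 1 n, (k : ℝ) * b k ^ q) ^ (1 / q) +
          (∑ k ∈ Finset.Icc 1 n, ((n : ℝ) - (k : ℝ)) * a k ^ p) ^ (1 / p) *
            (∑ k ∈ Finset.Icc 1 n, ((n : ℝ) - (k : ℝ)) * b k ^ q) ^ (1 / q)) := by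
  have conj : p.HolderConjugate q :=
    Real.holderConjugate_iff.mpr ⟨hp, by simpa only [one_div] using hpq⟩
  have ha' : ∀ k ∈ Finset.Icc 1 n, 0 ≤ a k := fun k hk => (ha k hk).le
  have hb' : ∀ k ∈ Finset.Icc 1 n, 0 ≤ b k := fun k hk => (hb k hk).le
  have hn' : (0 : ℝ) < n := Nat.cast_pos.mpr hn
  rw [one_div_mul_eq_div, le_div_iff₀' hn']
  calc (n : ℝ) * ∑ k ∈ Finset.Icc 1 n, a k * b k
      = ∑ k ∈ Finset.Icc 1 n, (k : ℝ) * (a k * b k) +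
          ∑ k ∈ Finset.Icc 1 n, ((n : ℝ) - k) * (a k * b k) := by
        rw [Finset.mul_sum, ← Finset.sum_add_distrib]
        exact Finset.sum_congr rfl fun k _ => by ring
    _ ≤ _ := add_le_add
        (sum_weight_mul_le_rpow_mul_rpow _ conj (fun k _ => Nat.cast_nonneg k) ha' hb')
        (sum_weight_mul_le_rpow_mul_rpow _ conj
          (fun k hk => sub_nonneg.mpr (Nat.cast_le.mpr (Finset.mem_Icc.mp hk).2)) ha' hb')
end

section
/- Let (E, Σ, μ) be a measure space with μ a positive measure, let p > 1 and 1/p + 1/q = 1, and let α, β, w, f, g : E → ℝ be nonnegative measurable functions with α + β = 1 on E, such that the functions α w f g, β w f g, α w f^p, α w g^q, β w f^p, β w g^q and w f g are all μ-integrable. Then ∫_E w f g dμ ≤ (∫_E α w f^p dμ)^{1/p} (∫_E α w g^q dμ)^{1/q} + (∫_E β w f^p dμ)^{1/p} (∫_E β w g^q dμ)^{1/q}. -/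
open MeasureTheory

lemma rpow_one_div_mul_rpow {a b r : ℝ} (ha : 0 ≤ a) (hb : 0 ≤ b) (hr : 0 < r) :
    (a ^ (1 / r) * b) ^ r = a * b ^ r := by
  rw [Real.mul_rpow (Real.rpow_nonneg ha _) hb, ← Real.rpow_mul ha, one_div_mul_cancel hr.ne',
    Real.rpow_one]

/-- If `v * f ^ p` is integrable, then `v ^ (1 / p) * f` belongs to `L^p`. -/
lemma memLp_rpow_mul_of_integrable {E : Type*} [MeasurableSpace E] {μ : Measure E} {p : ℝ}
    (hp : 0 < p) {v f : E → ℝ} (hvm : Measurable v) (hfm : Measurable f)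
    (hv : ∀ x, 0 ≤ v x) (hf : ∀ x, 0 ≤ f x) (h : Integrable (fun x => v x * f x ^ p) μ) :
    MemLp (fun x => v x ^ (1 / p) * f x) (ENNReal.ofReal p) μ := by
  have hm : Measurable fun x => v x ^ (1 / p) * f x := (hvm.pow_const _).mul hfm
  rw [← integrable_norm_rpow_iff hm.aestronglyMeasurable (by simp [hp]) (by simp),
    ENNReal.toReal_ofReal hp.le]
  refine h.congr (.of_forall fun x => ?_)
  simp only [Real.norm_of_nonneg (mul_nonneg (Real.rpow_nonneg (hv x) (1 / p)) (hf x)),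
    rpow_one_div_mul_rpow (hv x) (hf x) hp]

/-- Hölder's inequality for nonnegative functions with a nonnegative weight `v`. -/
lemma integral_weight_mul_le_Lp_mul_Lq {E : Type*} [MeasurableSpace E] {μ : Measure E} {p q : ℝ}
    (hpq : p.HolderConjugate q) {v f g : E → ℝ}
    (hvm : Measurable v) (hfm : Measurable f) (hgm : Measurable g)
    (hv : ∀ x, 0 ≤ v x) (hf : ∀ x, 0 ≤ f x) (hg : ∀ x, 0 ≤ g x)
    (hvf : Integrable (fun x => v x * f x ^ p) μ) (hvg : Integrable (fun x => v x * g x ^ q) μ) :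
    ∫ x, v x * f x * g x ∂μ ≤
      (∫ x, v x * f x ^ p ∂μ) ^ (1 / p) * (∫ x, v x * g x ^ q ∂μ) ^ (1 / q) := by
  have hmul (x : E) : v x ^ (1 / p) * f x * (v x ^ (1 / q) * g x) = v x * f x * g x := by
    have hvx : v x ^ (1 / p) * v x ^ (1 / q) = v x := by
      rw [← Real.rpow_add_of_nonneg (hv x) hpq.one_div_nonneg hpq.symm.one_div_nonneg,
        one_div, one_div, hpq.inv_add_inv_eq_one, Real.rpow_one]
    rw [mul_mul_mul_comm, hvx, mul_assoc]
  have key := integral_mul_le_Lp_mul_Lq_of_nonneg hpq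
    (.of_forall fun x => mul_nonneg (Real.rpow_nonneg (hv x) _) (hf x))
    (.of_forall fun x => mul_nonneg (Real.rpow_nonneg (hv x) _) (hg x))
    (memLp_rpow_mul_of_integrable hpq.pos hvm hfm hv hf hvf)
    (memLp_rpow_mul_of_integrable hpq.symm.pos hvm hgm hv hg hvg)
  simpa only [hmul, rpow_one_div_mul_rpow (hv _) (hf _) hpq.pos,
    rpow_one_div_mul_rpow (hv _) (hg _) hpq.symm.pos] using key

/-- Theorem 3.1(i): two-weight improvement of Hölder's inequality for the
isotonic linear functional `A(f) = ∫ f dμ` on a measure space. -/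
theorem improved_holder_functional_i {E : Type*} [MeasurableSpace E] (μ : Measure E)
    (p q : ℝ) (hp : 1 < p) (hpq : 1 / p + 1 / q = 1)
    (α β w f g : E → ℝ)
    (hαm : Measurable α) (hβm : Measurable β) (hwm : Measurable w)
    (hfm : Measurable f) (hgm : Measurable g)
    (hα : ∀ x, 0 ≤ α x) (hβ : ∀ x, 0 ≤ β x) (hw : ∀ x, 0 ≤ w x)
    (hf : ∀ x, 0 ≤ f x) (hg : ∀ x, 0 ≤ g x)
    (hαβ : ∀ x, α x + β x = 1)
    (h1 : Integrable (fun x => α x * w x * f x * g x) μ)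
    (h2 : Integrable (fun x => β x * w x * f x * g x) μ)
    (h3 : Integrable (fun x => α x * w x * f x ^ p) μ)
    (h4 : Integrable (fun x => α x * w x * g x ^ q) μ)
    (h5 : Integrable (fun x => β x * w x * f x ^ p) μ)
    (h6 : Integrable (fun x => β x * w x * g x ^ q) μ)
    (h7 : Integrable (fun x => w x * f x * g x) μ) :
    ∫ x, w x * f x * g x ∂μ ≤
      (∫ x, α x * w x * f x ^ p ∂μ) ^ (1 / p) * (∫ x, α x * w x * g x ^ q ∂μ) ^ (1 / q) +
        (∫ x, β x * w x * f x ^ p ∂μ) ^ (1 / p) * (∫ x, β x * w x * g x ^ q ∂μ) ^ (1 / q) := by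
  have hconj : p.HolderConjugate q :=
    Real.holderConjugate_iff.mpr ⟨hp, by simpa only [one_div] using hpq⟩
  have hsplit (x : E) :
      w x * f x * g x = α x * w x * f x * g x + β x * w x * f x * g x := by
    linear_combination -(w x * f x * g x) * hαβ x
  simp_rw [hsplit]
  rw [integral_add h1 h2]
  exact add_le_add
    (integral_weight_mul_le_Lp_mul_Lq hconj (hαm.mul hwm) hfm hgm
      (fun x => mul_nonneg (hα x) (hw x)) hf hg h3 h4)
    (integral_weight_mul_le_Lp_mul_Lq hconj (hβm.mul hwm) hfm hgm
      (fun x => mul_nonneg (hβ x) (hw x)) hf hg h5 h6)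
end

section
/- Let (E, Σ, μ) be a measure space with μ a positive measure, let p > 1 and 1/p + 1/q = 1, and let α, β, w, f, g : E → ℝ be nonnegative measurable functions with α + β = 1 on E, such that the functions α w f^p, α w g^q, β w f^p, β w g^q, w f^p and w g^q are all μ-integrable. Then (∫_E α w f^p dμ)^{1/p} (∫_E α w g^q dμ)^{1/q} + (∫_E β w f^p dμ)^{1/p} (∫_E β w g^q dμ)^{1/q} ≤ (∫_E w f^p dμ)^{1/p} (∫_E w g^q dμ)^{1/q}. -/
open MeasureTheory

/-- Hölder's inequality for two terms, with the exponents placed on the summands. -/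
theorem Real.rpow_mul_rpow_add_le_of_holderConjugate {p q a b c d : ℝ}
    (hpq : p.HolderConjugate q) (ha : 0 ≤ a) (hb : 0 ≤ b) (hc : 0 ≤ c) (hd : 0 ≤ d) :
    a ^ (1 / p) * b ^ (1 / q) + c ^ (1 / p) * d ^ (1 / q) ≤
      (a + c) ^ (1 / p) * (b + d) ^ (1 / q) := by
  have root_pow {x r : ℝ} (hx : 0 ≤ x) (hr : r ≠ 0) : (x ^ (1 / r)) ^ r = x := by
    rw [one_div, Real.rpow_inv_rpow hx hr]
  have key := Real.inner_le_Lp_mul_Lq_of_nonneg Finset.univ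
    (f := ![a ^ (1 / p), c ^ (1 / p)]) (g := ![b ^ (1 / q), d ^ (1 / q)]) hpq
    (by intro i _; fin_cases i <;> simp <;> positivity)
    (by intro i _; fin_cases i <;> simp <;> positivity)
  simpa only [Fin.sum_univ_two, Matrix.cons_val_zero, Matrix.cons_val_one,
    root_pow ha hpq.ne_zero, root_pow hc hpq.ne_zero, root_pow hb hpq.symm.ne_zero,
    root_pow hd hpq.symm.ne_zero] using key

/-- Theorem 3.1(ii): the two-weight refinement is sharper than the classical
Hölder bound, for the isotonic linear functional `A(f) = ∫ f dμ`. -/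
theorem improved_holder_functional_ii {E : Type*} [MeasurableSpace E] (μ : Measure E)
    (p q : ℝ) (hp : 1 < p) (hpq : 1 / p + 1 / q = 1)
    (α β w f g : E → ℝ)
    (hαm : Measurable α) (hβm : Measurable β) (hwm : Measurable w)
    (hfm : Measurable f) (hgm : Measurable g)
    (hα : ∀ x, 0 ≤ α x) (hβ : ∀ x, 0 ≤ β x) (hw : ∀ x, 0 ≤ w x)
    (hf : ∀ x, 0 ≤ f x) (hg : ∀ x, 0 ≤ g x)
    (hαβ : ∀ x, α x + β x = 1)
    (h3 : Integrable (fun x => α x * w x * f x ^ p) μ)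
    (h4 : Integrable (fun x => α x * w x * g x ^ q) μ)
    (h5 : Integrable (fun x => β x * w x * f x ^ p) μ)
    (h6 : Integrable (fun x => β x * w x * g x ^ q) μ)
    (h7 : Integrable (fun x => w x * f x ^ p) μ)
    (h8 : Integrable (fun x => w x * g x ^ q) μ) :
    (∫ x, α x * w x * f x ^ p ∂μ) ^ (1 / p) * (∫ x, α x * w x * g x ^ q ∂μ) ^ (1 / q) +
        (∫ x, β x * w x * f x ^ p ∂μ) ^ (1 / p) * (∫ x, β x * w x * g x ^ q ∂μ) ^ (1 / q) ≤
      (∫ x, w x * f x ^ p ∂μ) ^ (1 / p) * (∫ x, w x * g x ^ q ∂μ) ^ (1 / q) := by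
  have hconj : p.HolderConjugate q :=
    Real.holderConjugate_iff.mpr ⟨hp, by simpa only [one_div] using hpq⟩
  have split {u : E → ℝ} (hαu : Integrable (fun x => α x * w x * u x) μ)
      (hβu : Integrable (fun x => β x * w x * u x) μ) :
      ∫ x, w x * u x ∂μ = (∫ x, α x * w x * u x ∂μ) + ∫ x, β x * w x * u x ∂μ := by
    rw [← integral_add hαu hβu]
    congr 1 with x
    linear_combination (-(w x * u x)) * hαβ x
  have nonneg {γ u : E → ℝ} (hγ : ∀ x, 0 ≤ γ x) (hu : ∀ x, 0 ≤ u x) :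
      0 ≤ ∫ x, γ x * w x * u x ∂μ :=
    integral_nonneg fun x => mul_nonneg (mul_nonneg (hγ x) (hw x)) (hu x)
  have hfp x : 0 ≤ f x ^ p := Real.rpow_nonneg (hf x) p
  have hgq x : 0 ≤ g x ^ q := Real.rpow_nonneg (hg x) q
  rw [split h3 h5, split h4 h6]
  exact Real.rpow_mul_rpow_add_le_of_holderConjugate hconj
    (nonneg hα hfp) (nonneg hα hgq) (nonneg hβ hfp) (nonneg hβ hgq)
end

section
/- Let (E, Σ, μ) be a measure space with μ a positive measure, let p > 1 and 1/p + 1/q = 1, let m be a positive natural number, and let α_1, ..., α_m, w, f, g : E → ℝ be nonnegative measurable functions with ∑_{i=1}^m α_i = 1 on E, such that for each i the functions α_i w f^p, α_i w g^q, and also w f^p and w g^q, are μ-integrable. Then ∑_{i=1}^m (∫_E α_i w f^p dμ)^{1/p} (∫_E α_i w g^q dμ)^{1/q} ≤ (∫_E w f^p dμ)^{1/p} (∫_E w g^q dμ)^{1/q}. -/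
open MeasureTheory

/-- Theorem 3.2(ii): the `m`-weight refinement is sharper than the classical
Hölder bound, for the isotonic linear functional `A(f) = ∫ f dμ`. -/
theorem improved_holder_functional_m_ii {E : Type*} [MeasurableSpace E] (μ : Measure E)
    (p q : ℝ) (hp : 1 < p) (hpq : 1 / p + 1 / q = 1)
    (m : ℕ) (hm : 0 < m) (α : Fin m → E → ℝ) (w f g : E → ℝ)
    (hαm : ∀ i, Measurable (α i)) (hwm : Measurable w)
    (hfm : Measurable f) (hgm : Measurable g)
    (hα : ∀ i, ∀ x, 0 ≤ α i x) (hw : ∀ x, 0 ≤ w x)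
    (hf : ∀ x, 0 ≤ f x) (hg : ∀ x, 0 ≤ g x)
    (hαsum : ∀ x, ∑ i, α i x = 1)
    (h1 : ∀ i, Integrable (fun x => α i x * (w x * f x ^ p)) μ)
    (h2 : ∀ i, Integrable (fun x => α i x * (w x * g x ^ q)) μ)
    (h3 : Integrable (fun x => w x * f x ^ p) μ)
    (h4 : Integrable (fun x => w x * g x ^ q) μ) :
    ∑ i, (∫ x, α i x * (w x * f x ^ p) ∂μ) ^ (1 / p) *
        (∫ x, α i x * (w x * g x ^ q) ∂μ) ^ (1 / q) ≤
      (∫ x, w x * f x ^ p ∂μ) ^ (1 / p) * (∫ x, w x * g x ^ q ∂μ) ^ (1 / q) := by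
  have hc : p.HolderConjugate q := Real.holderConjugate_iff.2 ⟨hp, by simpa using hpq⟩
  have sum_integral : ∀ u : E → ℝ, (∀ i, Integrable (fun x => α i x * u x) μ) →
      ∫ x, u x ∂μ = ∑ i, ∫ x, α i x * u x ∂μ := fun u hu => by
    rw [← integral_finsetSum _ fun i _ => hu i]
    simp only [← Finset.sum_mul, hαsum, one_mul]
  have hF : ∀ i, 0 ≤ ∫ x, α i x * (w x * f x ^ p) ∂μ := fun i => integral_nonneg fun x =>
    mul_nonneg (hα i x) (mul_nonneg (hw x) (Real.rpow_nonneg (hf x) p))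
  have hG : ∀ i, 0 ≤ ∫ x, α i x * (w x * g x ^ q) ∂μ := fun i => integral_nonneg fun x =>
    mul_nonneg (hα i x) (mul_nonneg (hw x) (Real.rpow_nonneg (hg x) q))
  rw [sum_integral _ h1, sum_integral _ h2]
  refine (Real.inner_le_Lp_mul_Lq_of_nonneg Finset.univ hc
    (fun i _ => Real.rpow_nonneg (hF i) _) (fun i _ => Real.rpow_nonneg (hG i) _)).trans_eq ?_
  simp only [one_div, Real.rpow_inv_rpow (hF _) hc.ne_zero,
    Real.rpow_inv_rpow (hG _) hc.symm.ne_zero]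
end

section
/- Let p, q > 1 with 1/p + 1/q = 1, let a < b and c < d be real numbers, and let f, g be real functions on E = [a,b] × [c,d] such that |f|^p and |g|^q are Lebesgue integrable on E. Define the four weight functions α_1(x,y) = (b-x)(d-y)/((b-a)(d-c)), α_2(x,y) = (b-x)(y-c)/((b-a)(d-c)), α_3(x,y) = (x-a)(y-c)/((b-a)(d-c)), α_4(x,y) = (x-a)(d-y)/((b-a)(d-c)). Then ∫_a^b ∫_c^d |f(x,y)| |g(x,y)| dx dy ≤ ∑_{i=1}^4 (∫_a^b ∫_c^d α_i(x,y) |f(x,y)|^p dx dy)^{1/p} (∫_a^b ∫_c^d α_i(x,y) |g(x,y)|^q dx dy)^{1/q}. -/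
open MeasureTheory intervalIntegral

/-- If a power of a nonnegative real function with nonzero exponent is a.e. strongly measurable,
so is the function. -/
theorem aestronglyMeasurable_of_rpow {X : Type*} [MeasurableSpace X] {μ : Measure X} {p : ℝ}
    (hp : p ≠ 0) {u : X → ℝ} (hu0 : ∀ z, 0 ≤ u z)
    (hu : AEStronglyMeasurable (fun z => u z ^ p) μ) : AEStronglyMeasurable u μ := by
  have h : u = fun z => (u z ^ p) ^ p⁻¹ := by
    ext z
    exact (Real.rpow_rpow_inv (hu0 z) hp).symm
  rw [h]
  exact (hu.aemeasurable.pow_const _).aestronglyMeasurable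

/-- The product of two nonnegative functions with integrable conjugate powers is integrable. -/
theorem integrable_mul_of_rpow {X : Type*} [MeasurableSpace X] {μ : Measure X} {p q : ℝ}
    (hpq : p.HolderConjugate q) {u v : X → ℝ} (hu0 : ∀ z, 0 ≤ u z) (hv0 : ∀ z, 0 ≤ v z)
    (hu : Integrable (fun z => u z ^ p) μ) (hv : Integrable (fun z => v z ^ q) μ) :
    Integrable (fun z => u z * v z) μ := by
  refine ((hu.div_const p).add (hv.div_const q)).mono'
    ((aestronglyMeasurable_of_rpow hpq.ne_zero hu0 hu.1).mul
      (aestronglyMeasurable_of_rpow hpq.symm.ne_zero hv0 hv.1)) (.of_forall fun z => ?_)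
  rw [Real.norm_of_nonneg (mul_nonneg (hu0 z) (hv0 z))]
  exact Real.young_inequality_of_nonneg (hu0 z) (hv0 z) hpq

/-- Hölder's inequality with a nonnegative weight. -/
theorem integral_weight_mul_le {X : Type*} [MeasurableSpace X] {μ : Measure X} {p q : ℝ}
    (hpq : p.HolderConjugate q) {w u v : X → ℝ} (hw : AEStronglyMeasurable w μ)
    (hw0 : ∀ᵐ z ∂μ, 0 ≤ w z) (hu0 : ∀ z, 0 ≤ u z) (hv0 : ∀ z, 0 ≤ v z)
    (hum : AEStronglyMeasurable u μ) (hvm : AEStronglyMeasurable v μ)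
    (hu : Integrable (fun z => w z * u z ^ p) μ) (hv : Integrable (fun z => w z * v z ^ q) μ) :
    ∫ z, w z * (u z * v z) ∂μ ≤
      (∫ z, w z * u z ^ p ∂μ) ^ (1 / p) * (∫ z, w z * v z ^ q ∂μ) ^ (1 / q) := by
  have key {r : ℝ} (hr : 0 < r) {h : X → ℝ} (h0 : ∀ z, 0 ≤ h z) :
      ∀ᵐ z ∂μ, (w z ^ (1 / r) * h z) ^ r = w z * h z ^ r := by
    filter_upwards [hw0] with z hz
    rw [Real.mul_rpow (by positivity) (h0 z), one_div, Real.rpow_inv_rpow hz hr.ne']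
  have mem {r : ℝ} (hr : 0 < r) {h : X → ℝ} (h0 : ∀ z, 0 ≤ h z) (hm : AEStronglyMeasurable h μ)
      (hi : Integrable (fun z => w z * h z ^ r) μ) :
      MemLp (fun z => w z ^ (1 / r) * h z) (ENNReal.ofReal r) μ := by
    have hm' : AEStronglyMeasurable (fun z => w z ^ (1 / r) * h z) μ :=
      (hw.aemeasurable.pow_const _).aestronglyMeasurable.mul hm
    rw [← integrable_norm_rpow_iff hm' (by simpa using hr) ENNReal.ofReal_ne_top,
      ENNReal.toReal_ofReal hr.le]
    refine hi.congr ?_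
    filter_upwards [key hr h0, hw0] with z hz hz0
    rw [Real.norm_of_nonneg (mul_nonneg (Real.rpow_nonneg hz0 _) (h0 z)), hz]
  have nonneg (r : ℝ) {h : X → ℝ} (h0 : ∀ z, 0 ≤ h z) :
      0 ≤ᵐ[μ] fun z => w z ^ (1 / r) * h z := by
    filter_upwards [hw0] with z hz
    exact mul_nonneg (Real.rpow_nonneg hz _) (h0 z)
  have H := integral_mul_le_Lp_mul_Lq_of_nonneg hpq (nonneg p hu0) (nonneg q hv0)
    (mem hpq.pos hu0 hum hu) (mem hpq.symm.pos hv0 hvm hv)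
  rw [integral_congr_ae (key hpq.pos hu0), integral_congr_ae (key hpq.symm.pos hv0)] at H
  refine le_of_eq_of_le (integral_congr_ae ?_) H
  filter_upwards [hw0] with z hz
  have hsplit : w z = w z ^ (1 / p) * w z ^ (1 / q) := by
    rw [← Real.rpow_add_of_nonneg hz hpq.one_div_nonneg hpq.symm.one_div_nonneg, one_div, one_div,
      hpq.inv_add_inv_eq_one, Real.rpow_one]
  calc w z * (u z * v z) = w z ^ (1 / p) * w z ^ (1 / q) * (u z * v z) := by rw [← hsplit]
    _ = _ := by ring

/-- Fubini's theorem for iterated interval integrals over a rectangle. -/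
theorem intervalIntegral_intervalIntegral_eq_setIntegral {a b c d : ℝ} (hab : a ≤ b) (hcd : c ≤ d)
    {F : ℝ → ℝ → ℝ}
    (hF : IntegrableOn (fun z : ℝ × ℝ => F z.1 z.2) (Set.Icc a b ×ˢ Set.Icc c d)) :
    ∫ x in a..b, ∫ y in c..d, F x y =
      ∫ z in Set.Icc a b ×ˢ Set.Icc c d, F z.1 z.2 := by
  rw [Measure.volume_eq_prod] at hF ⊢
  rw [setIntegral_prod _ hF]
  simp only [integral_of_le hab, integral_of_le hcd, integral_Icc_eq_integral_Ioc]

/-- Hölder's inequality on a rectangle with a continuous weight that is nonnegative there. -/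
theorem setIntegral_weight_mul_le {a b c d p q : ℝ} (hab : a ≤ b) (hcd : c ≤ d)
    (hpq : p.HolderConjugate q) {f g w : ℝ → ℝ → ℝ}
    (hf : IntegrableOn (fun z : ℝ × ℝ => |f z.1 z.2| ^ p) (Set.Icc a b ×ˢ Set.Icc c d))
    (hg : IntegrableOn (fun z : ℝ × ℝ => |g z.1 z.2| ^ q) (Set.Icc a b ×ˢ Set.Icc c d))
    (hw : Continuous fun z : ℝ × ℝ => w z.1 z.2)
    (hw0 : ∀ x ∈ Set.Icc a b, ∀ y ∈ Set.Icc c d, 0 ≤ w x y) :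
    ∫ z in Set.Icc a b ×ˢ Set.Icc c d, w z.1 z.2 * (|f z.1 z.2| * |g z.1 z.2|) ≤
      (∫ x in a..b, ∫ y in c..d, w x y * |f x y| ^ p) ^ (1 / p) *
        (∫ x in a..b, ∫ y in c..d, w x y * |g x y| ^ q) ^ (1 / q) := by
  have hK : IsCompact (Set.Icc a b ×ˢ Set.Icc c d) := isCompact_Icc.prod isCompact_Icc
  have hwf := hf.continuousOn_mul hw.continuousOn hK
  have hwg := hg.continuousOn_mul hw.continuousOn hK
  rw [intervalIntegral_intervalIntegral_eq_setIntegral hab hcd hwf,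
    intervalIntegral_intervalIntegral_eq_setIntegral hab hcd hwg]
  refine integral_weight_mul_le hpq hw.aestronglyMeasurable ?_ (fun _ => abs_nonneg _)
    (fun _ => abs_nonneg _)
    (aestronglyMeasurable_of_rpow hpq.ne_zero (fun _ => abs_nonneg _) hf.1)
    (aestronglyMeasurable_of_rpow hpq.symm.ne_zero (fun _ => abs_nonneg _) hg.1) hwf hwg
  filter_upwards [ae_restrict_mem hK.measurableSet] with z hz
  exact hw0 _ hz.1 _ hz.2

/-- Improvement of Hölder's inequality for double integrals over a rectangle. -/
theorem improved_holder_double_integral (a b c d p q : ℝ)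
    (hab : a < b) (hcd : c < d) (hp : 1 < p) (hq : 1 < q) (hpq : 1 / p + 1 / q = 1)
    (f g : ℝ → ℝ → ℝ)
    (hf : IntegrableOn (fun z : ℝ × ℝ => |f z.1 z.2| ^ p)
      (Set.Icc a b ×ˢ Set.Icc c d) volume)
    (hg : IntegrableOn (fun z : ℝ × ℝ => |g z.1 z.2| ^ q)
      (Set.Icc a b ×ˢ Set.Icc c d) volume) :
    (∫ x in a..b, ∫ y in c..d, |f x y| * |g x y|) ≤
      (∫ x in a..b, ∫ y in c..d,
          ((b - x) * (d - y) / ((b - a) * (d - c))) * |f x y| ^ p) ^ (1 / p) *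
        (∫ x in a..b, ∫ y in c..d,
          ((b - x) * (d - y) / ((b - a) * (d - c))) * |g x y| ^ q) ^ (1 / q) +
      (∫ x in a..b, ∫ y in c..d,
          ((b - x) * (y - c) / ((b - a) * (d - c))) * |f x y| ^ p) ^ (1 / p) *
        (∫ x in a..b, ∫ y in c..d,
          ((b - x) * (y - c) / ((b - a) * (d - c))) * |g x y| ^ q) ^ (1 / q) +
      (∫ x in a..b, ∫ y in c..d,
          ((x - a) * (y - c) / ((b - a) * (d - c))) * |f x y| ^ p) ^ (1 / p) *
        (∫ x in a..b, ∫ y in c..d,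
          ((x - a) * (y - c) / ((b - a) * (d - c))) * |g x y| ^ q) ^ (1 / q) +
      (∫ x in a..b, ∫ y in c..d,
          ((x - a) * (d - y) / ((b - a) * (d - c))) * |f x y| ^ p) ^ (1 / p) *
        (∫ x in a..b, ∫ y in c..d,
          ((x - a) * (d - y) / ((b - a) * (d - c))) * |g x y| ^ q) ^ (1 / q) := by
  have hc : p.HolderConjugate q := by
    rw [Real.holderConjugate_iff]
    exact ⟨hp, by simpa only [one_div] using hpq⟩
  have hK : IsCompact (Set.Icc a b ×ˢ Set.Icc c d) := isCompact_Icc.prod isCompact_Icc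
  have hfg : IntegrableOn (fun z : ℝ × ℝ => |f z.1 z.2| * |g z.1 z.2|)
      (Set.Icc a b ×ˢ Set.Icc c d) :=
    integrable_mul_of_rpow hc (fun _ => abs_nonneg _) (fun _ => abs_nonneg _) hf hg
  have hba : 0 < b - a := sub_pos.2 hab
  have hdc : 0 < d - c := sub_pos.2 hcd
  have weighted {w : ℝ → ℝ → ℝ} (hw : Continuous fun z : ℝ × ℝ => w z.1 z.2) :
      IntegrableOn (fun z : ℝ × ℝ => w z.1 z.2 * (|f z.1 z.2| * |g z.1 z.2|))
        (Set.Icc a b ×ˢ Set.Icc c d) :=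
    hfg.continuousOn_mul hw.continuousOn hK
  have nonneg {s t : ℝ} (hs : 0 ≤ s) (ht : 0 ≤ t) : 0 ≤ s * t / ((b - a) * (d - c)) := by
    positivity
  let w₁ : ℝ → ℝ → ℝ := fun x y => (b - x) * (d - y) / ((b - a) * (d - c))
  let w₂ : ℝ → ℝ → ℝ := fun x y => (b - x) * (y - c) / ((b - a) * (d - c))
  let w₃ : ℝ → ℝ → ℝ := fun x y => (x - a) * (y - c) / ((b - a) * (d - c))
  let w₄ : ℝ → ℝ → ℝ := fun x y => (x - a) * (d - y) / ((b - a) * (d - c))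
  have hw₁ : Continuous fun z : ℝ × ℝ => w₁ z.1 z.2 := by fun_prop
  have hw₂ : Continuous fun z : ℝ × ℝ => w₂ z.1 z.2 := by fun_prop
  have hw₃ : Continuous fun z : ℝ × ℝ => w₃ z.1 z.2 := by fun_prop
  have hw₄ : Continuous fun z : ℝ × ℝ => w₄ z.1 z.2 := by fun_prop
  have hsum (x y : ℝ) : w₁ x y + w₂ x y + w₃ x y + w₄ x y = 1 := by
    simp only [w₁, w₂, w₃, w₄]
    field_simp
    ring
  have hsplit : ∀ z : ℝ × ℝ, |f z.1 z.2| * |g z.1 z.2| =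
      w₁ z.1 z.2 * (|f z.1 z.2| * |g z.1 z.2|) + w₂ z.1 z.2 * (|f z.1 z.2| * |g z.1 z.2|) +
      w₃ z.1 z.2 * (|f z.1 z.2| * |g z.1 z.2|) + w₄ z.1 z.2 * (|f z.1 z.2| * |g z.1 z.2|) := by
    intro z
    rw [← add_mul, ← add_mul, ← add_mul, hsum, one_mul]
  rw [intervalIntegral_intervalIntegral_eq_setIntegral hab.le hcd.le hfg,
    integral_congr_ae (.of_forall hsplit),
    integral_add ((Integrable.fun_add (weighted hw₁) (weighted hw₂)).fun_add (weighted hw₃))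
      (weighted hw₄),
    integral_add (Integrable.fun_add (weighted hw₁) (weighted hw₂)) (weighted hw₃),
    integral_add (weighted hw₁) (weighted hw₂)]
  refine add_le_add (add_le_add (add_le_add ?_ ?_) ?_) ?_
  · exact setIntegral_weight_mul_le hab.le hcd.le hc hf hg hw₁
      fun x hx y hy => nonneg (sub_nonneg.2 hx.2) (sub_nonneg.2 hy.2)
  · exact setIntegral_weight_mul_le hab.le hcd.le hc hf hg hw₂
      fun x hx y hy => nonneg (sub_nonneg.2 hx.2) (sub_nonneg.2 hy.1)
  · exact setIntegral_weight_mul_le hab.le hcd.le hc hf hg hw₃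
      fun x hx y hy => nonneg (sub_nonneg.2 hx.1) (sub_nonneg.2 hy.1)
  · exact setIntegral_weight_mul_le hab.le hcd.le hc hf hg hw₄
      fun x hx y hy => nonneg (sub_nonneg.2 hx.1) (sub_nonneg.2 hy.2)
end

section
/- Let q > 1 and let A, B, C, D ≥ 0 be real numbers. Then [ (4A + 2B + 2C + D)/36 ]^{1/q} + [ (2A + B + 4C + 2D)/36 ]^{1/q} + [ (2A + 4B + C + 2D)/36 ]^{1/q} + [ (A + 2B + 2C + 4D)/36 ]^{1/q} ≤ 4 · [ (A + B + C + D)/16 ]^{1/q}. -/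
/-- Jensen's inequality for the concave function `x ↦ x ^ p` and four equally weighted points. -/
theorem Real.add_four_rpow_le {p x y z w : ℝ} (hp₀ : 0 ≤ p) (hp₁ : p ≤ 1)
    (hx : 0 ≤ x) (hy : 0 ≤ y) (hz : 0 ≤ z) (hw : 0 ≤ w) :
    x ^ p + y ^ p + z ^ p + w ^ p ≤ 4 * ((x + y + z + w) / 4) ^ p := by
  have hmem : ∀ i ∈ (Finset.univ : Finset (Fin 4)), ![x, y, z, w] i ∈ Set.Ici (0 : ℝ) := by
    intro i _
    fin_cases i <;> simpa
  have hJensen := (Real.concaveOn_rpow hp₀ hp₁).le_map_sum (t := Finset.univ)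
    (w := fun _ : Fin 4 ↦ (1 / 4 : ℝ)) (by intros; norm_num) (by norm_num) hmem
  simp only [Fin.sum_univ_four, smul_eq_mul, Matrix.cons_val] at hJensen
  have hmean : 1 / 4 * x + 1 / 4 * y + 1 / 4 * z + 1 / 4 * w = (x + y + z + w) / 4 := by ring
  rw [hmean] at hJensen
  linarith

/-- The refined bound is at most the classical bound. -/
theorem refined_le_classical_bound (q A B C D : ℝ) (hq : 1 < q)
    (hA : 0 ≤ A) (hB : 0 ≤ B) (hC : 0 ≤ C) (hD : 0 ≤ D) :
    ((4 * A + 2 * B + 2 * C + D) / 36) ^ (1 / q) +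
        ((2 * A + B + 4 * C + 2 * D) / 36) ^ (1 / q) +
        ((2 * A + 4 * B + C + 2 * D) / 36) ^ (1 / q) +
        ((A + 2 * B + 2 * C + 4 * D) / 36) ^ (1 / q) ≤
      4 * ((A + B + C + D) / 16) ^ (1 / q) := by
  have hp₀ : 0 ≤ 1 / q := by positivity
  have hp₁ : 1 / q ≤ 1 := (div_le_one (by linarith)).2 hq.le
  refine (Real.add_four_rpow_le hp₀ hp₁ (by positivity) (by positivity) (by positivity)
    (by positivity)).trans_eq ?_
  congr 2
  ring
end
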